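/- arXiv:2410.02034 — 2 statements merged into one kernel-verified Lean document; each statement's English description precedes it below -/
import Mathlib

section
/- Let A be a primitive J(α,β)-axial algebra satisfying the (⋆) condition, generated by three primitive J(α,β)-axes a, b, c. Then A is spanned as an F-vector space by the nine elements a, b, c, ab, ac, bc, a(bc), b(ac), c(ab). -/
variable (F : Type*) [Field F] (A : Type*) [NonUnitalNonAssocCommRing A]
  [Module F A] [SMulCommClass F A A] [IsScalarTower F A A]

/-- The `l`-eigenspace of the left multiplication operator `ad_a`. -/
def eigSp (a : A) (l : F) : Submodule F A where
  carrier := {x | a * x = l • x}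
  add_mem' := by
    intro x y hx hy
    simp only [Set.mem_setOf_eq] at *
    rw [mul_add, hx, hy, smul_add]
  zero_mem' := by simp
  smul_mem' := by
    intro c x hx
    simp only [Set.mem_setOf_eq] at *
    rw [mul_smul_comm, hx, smul_comm]

/-- `a` is a `J(α,β)`-axis: an idempotent whose adjoint is semisimple with
eigenvalues among `1, α, β`, satisfying the fusion law `J(α,β)`. -/
structure IsJAxis (α β : F) (a : A) : Prop where
  idem : a * a = a
  decomp : eigSp F A a 1 ⊔ eigSp F A a α ⊔ eigSp F A a β = ⊤
  f11 : ∀ x ∈ eigSp F A a 1, ∀ y ∈ eigSp F A a 1, x * y ∈ eigSp F A a 1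
  f1a : ∀ x ∈ eigSp F A a 1, ∀ y ∈ eigSp F A a α, x * y ∈ eigSp F A a α
  f1b : ∀ x ∈ eigSp F A a 1, ∀ y ∈ eigSp F A a β, x * y ∈ eigSp F A a β
  faa : ∀ x ∈ eigSp F A a α, ∀ y ∈ eigSp F A a α, x * y ∈ eigSp F A a 1 ⊔ eigSp F A a α
  fab : ∀ x ∈ eigSp F A a α, ∀ y ∈ eigSp F A a β, x * y ∈ eigSp F A a β
  fbb : ∀ x ∈ eigSp F A a β, ∀ y ∈ eigSp F A a β, x * y ∈ eigSp F A a 1 ⊔ eigSp F A a α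

/-- A primitive `J(α,β)`-axis: `A_1(a) = F·a`. -/
def IsPrimJAxis (α β : F) (a : A) : Prop :=
  IsJAxis F A α β a ∧ eigSp F A a 1 = Submodule.span F {a}

/-- `A` is a primitive `J(α,β)`-axial algebra: generated as an `F`-algebra by a
set of primitive `J(α,β)`-axes. -/
def IsJAxialAlg (α β : F) : Prop :=
  ∃ S : Set A, (∀ a ∈ S, IsPrimJAxis F A α β a) ∧ NonUnitalAlgebra.adjoin F S = ⊤

/-- The `(⋆)` condition: for any two primitive axes `a, b`, writing
`b = x • a + bα + bβ`, the projection of `a` onto `A_1(b)` equals `x • b`. -/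
def StarCond (α β : F) : Prop :=
  ∀ a b : A, IsPrimJAxis F A α β a → IsPrimJAxis F A α β b →
    ∀ x : F, ∀ bα ∈ eigSp F A a α, ∀ bβ ∈ eigSp F A a β, b = x • a + bα + bβ →
      ∃ aα ∈ eigSp F A b α, ∃ aβ ∈ eigSp F A b β, a = x • b + aα + aβ

/-- A Frobenius form: a nonzero symmetric bilinear form that associates with
the product. -/
def IsFrobenius (B : A →ₗ[F] A →ₗ[F] F) : Prop :=
  B ≠ 0 ∧ (∀ u v, B u v = B v u) ∧ ∀ u v w, B u (v * w) = B (u * v) w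

/-- `τ` is the Miyamoto involution associated to the axis `a`: it fixes
`A_1(a) ⊕ A_α(a)` pointwise and negates `A_β(a)`. -/
def IsMiyamoto (α β : F) (a : A) (τ : A →ₗ[F] A) : Prop :=
  (∀ x ∈ eigSp F A a 1 ⊔ eigSp F A a α, τ x = x) ∧ ∀ x ∈ eigSp F A a β, τ x = -x

section helpers

variable {F A}

theorem hp_dec {α β : F} {a : A} (ha : IsPrimJAxis F A α β a) (x : A) :
    ∃ (t : F) (u v : A), a * u = α • u ∧ a * v = β • v ∧ x = t • a + u + v := by
  have h : x ∈ eigSp F A a 1 ⊔ eigSp F A a α ⊔ eigSp F A a β := by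
    rw [ha.1.decomp]; trivial
  rw [ha.2] at h
  obtain ⟨y, hy, v, hv, rfl⟩ := Submodule.mem_sup.1 h
  obtain ⟨z, hz, u, hu, rfl⟩ := Submodule.mem_sup.1 hy
  obtain ⟨t, rfl⟩ := Submodule.mem_span_singleton.1 hz
  exact ⟨t, u, v, hu, hv, rfl⟩

theorem hp_even {α β : F} {a : A} (ha : IsPrimJAxis F A α β a) {x : A}
    (h : x ∈ eigSp F A a 1 ⊔ eigSp F A a α) :
    ∃ (t : F) (u : A), a * u = α • u ∧ x = t • a + u := by
  rw [ha.2] at h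
  obtain ⟨z, hz, u, hu, rfl⟩ := Submodule.mem_sup.1 h
  obtain ⟨t, rfl⟩ := Submodule.mem_span_singleton.1 hz
  exact ⟨t, u, hu, rfl⟩

theorem hp_aa {α β : F} {a : A} (ha : IsPrimJAxis F A α β a) {x y : A}
    (hx : a * x = α • x) (hy : a * y = α • y) :
    ∃ (t : F) (u : A), a * u = α • u ∧ x * y = t • a + u :=
  hp_even ha (ha.1.faa x hx y hy)

theorem hp_bb {α β : F} {a : A} (ha : IsPrimJAxis F A α β a) {x y : A}
    (hx : a * x = β • x) (hy : a * y = β • y) :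
    ∃ (t : F) (u : A), a * u = α • u ∧ x * y = t • a + u :=
  hp_even ha (ha.1.fbb x hx y hy)

theorem hp_ab {α β : F} {a : A} (ha : IsPrimJAxis F A α β a) {x y : A}
    (hx : a * x = α • x) (hy : a * y = β • y) : a * (x * y) = β • (x * y) :=
  ha.1.fab x hx y hy

theorem hp_two {α β : F} (hαβ : α ≠ β) (W : Submodule F A) {u v : A}
    (h1 : u + v ∈ W) (h2 : α • u + β • v ∈ W) : u ∈ W ∧ v ∈ W := by
  have hne : α - β ≠ 0 := sub_ne_zero.2 hαβ
  have hu : u ∈ W := by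
    rw [← W.smul_mem_iff hne]
    have := W.sub_mem h2 (W.smul_mem β h1)
    convert this using 1
    module
  exact ⟨hu, (W.add_mem_iff_right hu).1 h1⟩

/-- components of an element of `W`. -/
theorem hp_comp {α β : F} (hαβ : α ≠ β) {a : A} (haa : a * a = a) (W : Submodule F A)
    (haW : a ∈ W) {t : F} {u v : A} (hu : a * u = α • u) (hv : a * v = β • v)
    (hx : t • a + u + v ∈ W) (hax : a * (t • a + u + v) ∈ W) : u ∈ W ∧ v ∈ W := by
  apply hp_two hαβ W
  · have := W.sub_mem hx (W.smul_mem t haW)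
    convert this using 1
    module
  · rw [mul_add, mul_add, mul_smul_comm, haa, hu, hv] at hax
    have := W.sub_mem hax (W.smul_mem t haW)
    convert this using 1
    module

theorem hp_key {α β : F} (h2 : (2 : F) ≠ 0) (hαβ : α ≠ β) {a b c : A}
    (ha : IsPrimJAxis F A α β a) (W : Submodule F A)
    (m1 : a ∈ W) (m2 : b ∈ W) (m3 : c ∈ W) (m4 : a * b ∈ W) (m5 : a * c ∈ W)
    (m6 : b * c ∈ W) (m7 : a * (b * c) ∈ W) (m8 : b * (a * c) ∈ W) (m9 : c * (a * b) ∈ W) :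
    a * a ∈ W ∧ a * (a * b) ∈ W ∧ a * (a * c) ∈ W ∧ a * (a * (b * c)) ∈ W ∧
      a * (b * (a * c)) ∈ W ∧ a * (c * (a * b)) ∈ W := by
  have haa : a * a = a := ha.1.idem
  obtain ⟨s, b1, b2, hb1, hb2, rfl⟩ := hp_dec ha b
  obtain ⟨t, c1, c2, hc1, hc2, rfl⟩ := hp_dec ha c
  obtain ⟨wb1, wb2⟩ := hp_comp hαβ haa W m1 hb1 hb2 m2 m4
  obtain ⟨wc1, wc2⟩ := hp_comp hαβ haa W m1 hc1 hc2 m3 m5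
  obtain ⟨p, P, hP, eP⟩ := hp_aa ha hb1 hc1
  obtain ⟨q, Q, hQ, eQ⟩ := hp_bb ha hb2 hc2
  have hR := hp_ab ha hb1 hc2
  have hS := hp_ab ha hc1 hb2
  obtain ⟨R, eR⟩ : ∃ R, R = b1 * c2 := ⟨_, rfl⟩
  obtain ⟨S, eS⟩ : ∃ S, S = c1 * b2 := ⟨_, rfl⟩
  rw [← eR] at hR
  rw [← eS] at hS
  have cP : c1 * b1 = p • a + P := by rw [mul_comm, eP]
  have cQ : c2 * b2 = q • a + Q := by rw [mul_comm, eQ]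
  have cR : c2 * b1 = R := by rw [mul_comm, eR]
  have cS : b2 * c1 = S := by rw [mul_comm, eS]
  have d1 : b1 * a = α • b1 := by rw [mul_comm, hb1]
  have d2 : b2 * a = β • b2 := by rw [mul_comm, hb2]
  have d3 : c1 * a = α • c1 := by rw [mul_comm, hc1]
  have d4 : c2 * a = β • c2 := by rw [mul_comm, hc2]
  have hne : β - α ≠ 0 := sub_ne_zero.2 (Ne.symm hαβ)
  simp only [mul_add, add_mul, mul_smul_comm, smul_mul_assoc, smul_add, haa, hb1, hb2, hc1, hc2,
    eP, eQ, ← eR, ← eS, cP, cQ, cR, cS, d1, d2, d3, d4, hP, hQ, hR, hS] at m6 m7 m8 m9 ⊢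
  have red : ∀ {x y : A} (k k1 k2 k3 k4 : F), y ∈ W →
      x = y + (k • a + k1 • b1 + k2 • b2 + k3 • c1 + k4 • c2) → x ∈ W := by
    rintro x y k k1 k2 k3 k4 hy rfl
    exact W.add_mem hy (W.add_mem (W.add_mem (W.add_mem (W.add_mem (W.smul_mem _ m1)
      (W.smul_mem _ wb1)) (W.smul_mem _ wb2)) (W.smul_mem _ wc1)) (W.smul_mem _ wc2))
  have n6 : (P + Q) + (R + S) ∈ W :=
    red (-(s * t + p + q)) (-(t * α)) (-(t * β)) (-(s * α)) (-(s * β)) m6 (by module)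
  have n7 : α • (P + Q) + β • (R + S) ∈ W :=
    red (-(s * t + p + q)) (-(t * α * α)) (-(t * β * β)) (-(s * α * α)) (-(s * β * β)) m7
      (by module)
  have n8 : α • P + β • Q + β • R + α • S ∈ W :=
    red (-(s * t + α * p + β * q)) (-(t * α)) (-(t * β)) (-(s * α * α)) (-(s * β * β)) m8
      (by module)
  have n9 : α • P + β • Q + α • R + β • S ∈ W :=
    red (-(s * t + α * p + β * q)) (-(t * α * α)) (-(t * β * β)) (-(s * α)) (-(s * β)) m9
      (by module)
  obtain ⟨wPQ, wRS⟩ := hp_two hαβ W n6 n7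
  have wR : R ∈ W := by
    rw [← W.smul_mem_iff (mul_ne_zero h2 hne)]
    have := W.add_mem (W.sub_mem n8 n9) (W.smul_mem (β - α) wRS)
    convert this using 1
    module
  have wS : S ∈ W := (W.add_mem_iff_right wR).1 wRS
  obtain ⟨wP, wQ⟩ : P ∈ W ∧ Q ∈ W := by
    apply hp_two hαβ W wPQ
    have := W.sub_mem (W.sub_mem n8 (W.smul_mem β wR)) (W.smul_mem α wS)
    convert this using 1
    module
  refine ⟨?_, ?_, ?_, ?_, ?_, ?_⟩
  all_goals
    repeat' first
      | assumption
      | apply W.add_mem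
      | apply W.smul_mem

/-- `y` stabilizes `W` implies `a * y` stabilizes `W`. -/
theorem hp_stab {α β : F} (hαβ : α ≠ β) {a : A} (ha : IsPrimJAxis F A α β a)
    (W : Submodule F A) (haW : a ∈ W) (hinv : ∀ w ∈ W, a * w ∈ W) {y : A}
    (hy : ∀ w ∈ W, y * w ∈ W) : ∀ w ∈ W, (a * y) * w ∈ W := by
  have haa : a * a = a := ha.1.idem
  obtain ⟨t, u, v, hu, hv, rfl⟩ := hp_dec ha y
  have hua : u * a = α • u := by rw [mul_comm, hu]
  have hva : v * a = β • v := by rw [mul_comm, hv]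
  have hvS : ∀ w ∈ W, v * w ∈ W := by
    intro w hw
    obtain ⟨r, x, z, hx, hz, rfl⟩ := hp_dec ha w
    obtain ⟨wx, wz⟩ := hp_comp hαβ haa W haW hx hz hw (hinv _ hw)
    have k1 : v * a ∈ W := by
      have h1 := hy a haW
      have e : (t • a + u + v) * a = t • a + α • u + β • v := by
        simp only [add_mul, smul_mul_assoc, haa, hua, hva]
      rw [e] at h1
      rw [hva]
      exact (hp_comp hαβ haa W haW (by rw [mul_smul_comm, hu]) (by rw [mul_smul_comm, hv])
        h1 (hinv _ h1)).2
    have k2 : v * x ∈ W := by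
      have h1 := hy x wx
      obtain ⟨k, p, hp, ep⟩ := hp_aa ha hu hx
      have e : (t • a + u + v) * x = k • a + ((t * α) • x + p) + v * x := by
        simp only [add_mul, smul_mul_assoc, hx, ep]
        module
      rw [e] at h1
      refine (hp_comp hαβ haa W haW ?_ ?_ h1 (hinv _ h1)).2
      · rw [mul_add, mul_smul_comm, hx, hp]
        module
      · rw [mul_comm v x]
        exact hp_ab ha hx hv
    have k3 : v * z ∈ W := by
      have h1 := hy z wz
      obtain ⟨k, p, hp, ep⟩ := hp_bb ha hv hz
      have e : (t • a + u + v) * z = k • a + p + ((t * β) • z + u * z) := by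
        simp only [add_mul, smul_mul_assoc, hz, ep]
        module
      rw [e] at h1
      rw [ep]
      refine W.add_mem (W.smul_mem _ haW) (hp_comp hαβ haa W haW hp ?_ h1 (hinv _ h1)).1
      rw [mul_add, mul_smul_comm, hz, hp_ab ha hu hz]
      module
    rw [mul_add, mul_add, mul_smul_comm]
    exact W.add_mem (W.add_mem (W.smul_mem _ k1) k2) k3
  intro w hw
  have e : (a * (t • a + u + v)) * w
      = α • ((t • a + u + v) * w) + (t - α * t) • (a * w) + (β - α) • (v * w) := by
    simp only [mul_add, mul_smul_comm, haa, hu, hv, add_mul, smul_mul_assoc]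
    module
  rw [e]
  exact W.add_mem (W.add_mem (W.smul_mem _ (hy w hw)) (W.smul_mem _ (hinv w hw)))
    (W.smul_mem _ (hvS w hw))

end helpers

theorem three_generated_product_span (α β : F) (h2 : (2 : F) ≠ 0)
    (hα1 : α ≠ 1) (hβ1 : β ≠ 1) (hαβ : α ≠ β)
    (hA : IsJAxialAlg F A α β) (hstar : StarCond F A α β)
    (a b c : A) (ha : IsPrimJAxis F A α β a) (hb : IsPrimJAxis F A α β b)
    (hc : IsPrimJAxis F A α β c)
    (hgen : NonUnitalAlgebra.adjoin F {a, b, c} = ⊤) :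
    Submodule.span F
      {a, b, c, a * b, a * c, b * c, a * (b * c), b * (a * c), c * (a * b)} = ⊤ := by
  set G : Set A := {a, b, c, a * b, a * c, b * c, a * (b * c), b * (a * c), c * (a * b)} with hG
  set W := Submodule.span F G with hW
  have hsub : ∀ x ∈ G, x ∈ W := fun x hx => Submodule.subset_span hx
  have m1 : a ∈ W := hsub _ (by simp [hG])
  have m2 : b ∈ W := hsub _ (by simp [hG])
  have m3 : c ∈ W := hsub _ (by simp [hG])
  have m4 : a * b ∈ W := hsub _ (by simp [hG])
  have m5 : a * c ∈ W := hsub _ (by simp [hG])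
  have m6 : b * c ∈ W := hsub _ (by simp [hG])
  have m7 : a * (b * c) ∈ W := hsub _ (by simp [hG])
  have m8 : b * (a * c) ∈ W := hsub _ (by simp [hG])
  have m9 : c * (a * b) ∈ W := hsub _ (by simp [hG])
  -- a linear subspace containing the nine generators contains `W`
  have ext : ∀ T : Submodule F A, a ∈ T → b ∈ T → c ∈ T → a * b ∈ T → a * c ∈ T → b * c ∈ T →
      a * (b * c) ∈ T → b * (a * c) ∈ T → c * (a * b) ∈ T → W ≤ T := by
    intro T h1 h2 h3 h4 h5 h6 h7 h8 h9
    refine Submodule.span_le.2 ?_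
    intro x hx
    simp only [hG, Set.mem_insert_iff, Set.mem_singleton_iff] at hx
    rcases hx with rfl | rfl | rfl | rfl | rfl | rfl | rfl | rfl | rfl <;> assumption
  have ba : b * a = a * b := mul_comm _ _
  have ca : c * a = a * c := mul_comm _ _
  have cb : c * b = b * c := mul_comm _ _
  have ia : ∀ w ∈ W, a * w ∈ W := by
    obtain ⟨n1, n2, n3, n4, n5, n6⟩ := hp_key h2 hαβ ha W m1 m2 m3 m4 m5 m6 m7 m8 m9
    exact ext (W.comap (LinearMap.mulLeft F a)) n1 m4 m5 n2 n3 m7 n4 n5 n6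
  have ib : ∀ w ∈ W, b * w ∈ W := by
    obtain ⟨n1, n2, n3, n4, n5, n6⟩ := hp_key h2 hαβ hb W (b := a) (c := c) m2 m1 m3
      (ba ▸ m4) m6 m5 m8 m7 (ba.symm ▸ m9)
    rw [ba] at n2 n6
    exact ext (W.comap (LinearMap.mulLeft F b)) (ba.symm ▸ m4 : b * a ∈ W) n1 m6 n2 m8 n3 n5 n4 n6
  have ic : ∀ w ∈ W, c * w ∈ W := by
    obtain ⟨n1, n2, n3, n4, n5, n6⟩ := hp_key h2 hαβ hc W (b := a) (c := b) m3 m1 m2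
      (ca.symm ▸ m5) (cb.symm ▸ m6) m4 m9 (cb.symm ▸ m7) (ca.symm ▸ m8)
    rw [ca] at n2 n6
    rw [cb] at n3 n5
    exact ext (W.comap (LinearMap.mulLeft F c)) (ca.symm ▸ m5 : c * a ∈ W)
      (cb.symm ▸ m6 : c * b ∈ W) n1 m9 n2 n3 n5 n6 n4
  let T : Submodule F A :=
    { carrier := {x | ∀ w ∈ W, x * w ∈ W}
      add_mem' := by
        intro x y hx hy w hw
        rw [add_mul]
        exact W.add_mem (hx w hw) (hy w hw)
      zero_mem' := by
        intro w _
        rw [zero_mul]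
        exact W.zero_mem
      smul_mem' := by
        intro k x hx w hw
        rw [smul_mul_assoc]
        exact W.smul_mem k (hx w hw) }
  have sa : ∀ y, y ∈ T → a * y ∈ T := fun y hy => hp_stab hαβ ha W m1 ia hy
  have sb : ∀ y, y ∈ T → b * y ∈ T := fun y hy => hp_stab hαβ hb W m2 ib hy
  have sc : ∀ y, y ∈ T → c * y ∈ T := fun y hy => hp_stab hαβ hc W m3 ic hy
  have hWT : W ≤ T := ext T ia ib ic (sa _ ib) (sa _ ic) (sb _ ic) (sa _ (sb _ ic))
    (sb _ (sa _ ic)) (sc _ (sa _ ib))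
  let N : NonUnitalSubalgebra F A :=
    { W with mul_mem' := fun {x y} hx hy => hWT hx y hy }
  have hN : NonUnitalAlgebra.adjoin F {a, b, c} ≤ N := by
    refine NonUnitalAlgebra.adjoin_le ?_
    intro x hx
    simp only [Set.mem_insert_iff, Set.mem_singleton_iff] at hx
    rcases hx with rfl | rfl | rfl
    · exact m1
    · exact m2
    · exact m3
  rw [hgen] at hN
  rw [eq_top_iff]
  intro x _
  exact hN (NonUnitalAlgebra.mem_top : x ∈ (⊤ : NonUnitalSubalgebra F A))
end

section
/- Let A be a primitive J(α,β)-axial algebra satisfying the (⋆) condition, generated by three primitive J(α,β)-axes a, b, c, and suppose that A_α(a)·A_α(a) ⊆ A_1(a). Then A is spanned as an F-vector space by the eight elements a, b, c, ab, ac, bc, a(bc), b(ac); in particular dim_F A ≤ 8. -/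
variable (F : Type*) [Field F] (A : Type*) [NonUnitalNonAssocCommRing A]
  [Module F A] [SMulCommClass F A A] [IsScalarTower F A A]

section Helpers

variable {F A}

lemma prim_decomp {α β : F} {a : A} (ha : IsPrimJAxis F A α β a) (x : A) :
    ∃ (p : F) (u v : A), a * u = α • u ∧ a * v = β • v ∧ x = p • a + u + v := by
  have hx : x ∈ eigSp F A a 1 ⊔ eigSp F A a α ⊔ eigSp F A a β := by
    rw [ha.1.decomp]; trivial
  obtain ⟨w, hw, v, hv, rfl⟩ := Submodule.mem_sup.1 hx
  obtain ⟨w1, hw1, u, hu, rfl⟩ := Submodule.mem_sup.1 hw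
  rw [ha.2] at hw1
  obtain ⟨p, rfl⟩ := Submodule.mem_span_singleton.1 hw1
  exact ⟨p, u, v, hu, hv, rfl⟩

lemma even_decomp {α β : F} {a : A} (ha : IsPrimJAxis F A α β a) {x : A}
    (hx : x ∈ eigSp F A a 1 ⊔ eigSp F A a α) : ∃ p : F, a * x = α • x + p • a := by
  obtain ⟨w1, hw1, u, hu, rfl⟩ := Submodule.mem_sup.1 hx
  rw [ha.2] at hw1
  obtain ⟨p, rfl⟩ := Submodule.mem_span_singleton.1 hw1
  have hu' : a * u = α • u := hu
  refine ⟨p - α * p, ?_⟩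
  rw [mul_add, mul_smul_comm, ha.1.idem, hu']
  module

/-- A submodule containing `a`, `x`, `a * x` contains the components of `x`. -/
lemma comps_mem {α β : F} (hαβ : α ≠ β) {a : A} (haa : a * a = a) (S : Submodule F A)
    {p : F} {u v : A} (hu : a * u = α • u) (hv : a * v = β • v)
    (h1 : a ∈ S) (h2 : p • a + u + v ∈ S) (h3 : a * (p • a + u + v) ∈ S) :
    u ∈ S ∧ v ∈ S := by
  have hd : α - β ≠ 0 := sub_ne_zero.2 hαβ
  rw [mul_add, mul_add, mul_smul_comm, haa, hu, hv] at h3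
  have e1 : (α - β) • u ∈ S := by
    have := S.sub_mem (S.sub_mem h3 (S.smul_mem β h2)) (S.smul_mem (p - β * p) h1)
    convert this using 1
    module
  have e1' : u ∈ S := (S.smul_mem_iff hd).1 e1
  refine ⟨e1', ?_⟩
  have := S.sub_mem (S.sub_mem h2 (S.smul_mem p h1)) e1'
  convert this using 1
  module

/-- The key closure property, valid for any primitive axis. -/
lemma key_closure {α β : F} (h2 : (2 : F) ≠ 0) (hαβ : α ≠ β) {a : A}
    (ha : IsPrimJAxis F A α β a) (S : Submodule F A) {x y : A}
    (h_a : a ∈ S) (h_x : x ∈ S) (h_y : y ∈ S) (h_ax : a * x ∈ S) (h_ay : a * y ∈ S)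
    (h_xy : x * y ∈ S) (h_axy : a * (x * y) ∈ S)
    (h_q : (a * x) * y ∈ S) (h_r : x * (a * y) ∈ S) :
    a * ((a * x) * y) ∈ S ∧ a * (x * (a * y)) ∈ S := by
  have haa := ha.1.idem
  obtain ⟨p, u, v, hu, hv, rfl⟩ := prim_decomp ha x
  obtain ⟨q, s, t, hs, ht, rfl⟩ := prim_decomp ha y
  obtain ⟨mu, mv⟩ := comps_mem hαβ haa S hu hv h_a h_x h_ax
  obtain ⟨ms, mt⟩ := comps_mem hαβ haa S hs ht h_a h_y h_ay
  obtain ⟨k1, hus⟩ := even_decomp ha (ha.1.faa u hu s hs)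
  obtain ⟨k2, hvt⟩ := even_decomp ha (ha.1.fbb v hv t ht)
  have hut : a * (u * t) = β • (u * t) := ha.1.fab u hu t ht
  have hvs : a * (v * s) = β • (v * s) := by
    have h : a * (s * v) = β • (s * v) := ha.1.fab s hs v hv
    rwa [mul_comm s v] at h
  have hua : u * a = α • u := by rw [mul_comm, hu]
  have hva : v * a = β • v := by rw [mul_comm, hv]
  have hd : α - β ≠ 0 := sub_ne_zero.2 hαβ
  simp only [mul_add, add_mul, mul_smul_comm, smul_mul_assoc, haa, hu, hv, hs, ht, hua, hva,
    hus, hut, hvs, hvt, smul_add] at *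
  have sm : ∀ (k : F) {z : A}, z ∈ S → k • z ∈ S := fun k z hz => S.smul_mem k hz
  have lin : ∀ k1 k2 k3 k4 k5 : F, k1 • a + k2 • u + k3 • v + k4 • s + k5 • t ∈ S :=
    fun k1 k2 k3 k4 k5 => S.add_mem (S.add_mem (S.add_mem (S.add_mem (sm _ h_a) (sm _ mu))
      (sm _ mv)) (sm _ ms)) (sm _ mt)
  have b1 : u * s + u * t + v * s + v * t ∈ S := by
    have := S.sub_mem h_xy (lin (p * q) (q * α) (q * β) (p * α) (p * β))
    convert this using 1
    module
  have b2 : α • (u * s + v * t) + β • (u * t + v * s) ∈ S := by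
    have := S.sub_mem h_axy
      (lin (p * q + k1 + k2) (q * α * α) (q * β * β) (p * α * α) (p * β * β))
    convert this using 1
    module
  have b3 : α • (u * s + u * t) + β • (v * s + v * t) ∈ S := by
    have := S.sub_mem h_q (lin (p * q) (q * α * α) (q * β * β) (p * α) (p * β))
    convert this using 1
    module
  have b4 : α • (u * s + v * s) + β • (u * t + v * t) ∈ S := by
    have := S.sub_mem h_r (lin (p * q) (q * α) (q * β) (p * α * α) (p * β * β))
    convert this using 1
    module
  have c1 : u * s + v * t ∈ S := by
    refine (S.smul_mem_iff hd).1 ?_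
    have := S.sub_mem b2 (sm β b1)
    convert this using 1
    module
  have c2 : u * s + u * t ∈ S := by
    refine (S.smul_mem_iff hd).1 ?_
    have := S.sub_mem b3 (sm β b1)
    convert this using 1
    module
  have c3 : u * s + v * s ∈ S := by
    refine (S.smul_mem_iff hd).1 ?_
    have := S.sub_mem b4 (sm β b1)
    convert this using 1
    module
  have m1 : u * s ∈ S := by
    refine (S.smul_mem_iff h2).1 ?_
    have := S.sub_mem (S.add_mem (S.add_mem c1 c2) c3) b1
    convert this using 1
    module
  have m2 : v * t ∈ S := (S.add_mem_iff_right m1).1 c1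
  have m3 : u * t ∈ S := (S.add_mem_iff_right m1).1 c2
  have m4 : v * s ∈ S := (S.add_mem_iff_right m1).1 c3
  constructor <;>
  · repeat' (first | apply S.add_mem | apply S.smul_mem | assumption)

/-- Under the stronger fusion rule, `(a * x) * y` is redundant. -/
lemma third_mem {α β : F} (hαβ : α ≠ β) {a : A}
    (ha : IsPrimJAxis F A α β a)
    (hfus : ∀ x ∈ eigSp F A a α, ∀ y ∈ eigSp F A a α, x * y ∈ eigSp F A a 1)
    (S : Submodule F A) {x y : A}
    (h_a : a ∈ S) (h_x : x ∈ S) (h_y : y ∈ S) (h_ax : a * x ∈ S) (h_ay : a * y ∈ S)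
    (h_xy : x * y ∈ S) (h_axy : a * (x * y) ∈ S) (h_r : x * (a * y) ∈ S) :
    (a * x) * y ∈ S := by
  have haa := ha.1.idem
  obtain ⟨p, u, v, hu, hv, rfl⟩ := prim_decomp ha x
  obtain ⟨q, s, t, hs, ht, rfl⟩ := prim_decomp ha y
  obtain ⟨mu, mv⟩ := comps_mem hαβ haa S hu hv h_a h_x h_ax
  obtain ⟨ms, mt⟩ := comps_mem hαβ haa S hs ht h_a h_y h_ay
  have hus := hfus u hu s hs
  rw [ha.2] at hus
  obtain ⟨k1, hus⟩ := Submodule.mem_span_singleton.1 hus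
  replace hus := hus.symm
  obtain ⟨k2, hvt⟩ := even_decomp ha (ha.1.fbb v hv t ht)
  have hut : a * (u * t) = β • (u * t) := ha.1.fab u hu t ht
  have hvs : a * (v * s) = β • (v * s) := by
    have h : a * (s * v) = β • (s * v) := ha.1.fab s hs v hv
    rwa [mul_comm s v] at h
  have hua : u * a = α • u := by rw [mul_comm, hu]
  have hva : v * a = β • v := by rw [mul_comm, hv]
  have sm : ∀ (k : F) {z : A}, z ∈ S → k • z ∈ S := fun k z hz => S.smul_mem k hz
  have lin : ∀ k1 k2 k3 k4 k5 : F, k1 • a + k2 • u + k3 • v + k4 • s + k5 • t ∈ S :=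
    fun k1 k2 k3 k4 k5 => S.add_mem (S.add_mem (S.add_mem (S.add_mem (sm _ h_a) (sm _ mu))
      (sm _ mv)) (sm _ ms)) (sm _ mt)
  simp only [mul_add, add_mul, mul_smul_comm, smul_mul_assoc, haa, hu, hv, hs, ht, hua, hva,
    hus, hut, hvs, hvt, smul_add] at *
  have b1 : u * t + v * s + v * t ∈ S := by
    have := S.sub_mem h_xy (lin (p * q + k1) (q * α) (q * β) (p * α) (p * β))
    convert this using 1
    module
  have b2 : α • (v * t) + β • (u * t + v * s) ∈ S := by
    have := S.sub_mem h_axy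
      (lin (p * q + k1 + k2) (q * α * α) (q * β * β) (p * α * α) (p * β * β))
    convert this using 1
    module
  have b4 : α • (v * s) + β • (u * t + v * t) ∈ S := by
    have := S.sub_mem h_r (lin (p * q + α * k1) (q * α) (q * β) (p * α * α) (p * β * β))
    convert this using 1
    module
  have hd : α - β ≠ 0 := sub_ne_zero.2 hαβ
  have m2 : v * t ∈ S := by
    refine (S.smul_mem_iff hd).1 ?_
    have := S.sub_mem b2 (sm β b1)
    convert this using 1
    module
  have m4 : v * s ∈ S := by
    refine (S.smul_mem_iff hd).1 ?_
    have := S.sub_mem b4 (sm β b1)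
    convert this using 1
    module
  have m3 : u * t ∈ S := by
    have := S.sub_mem (S.sub_mem b1 m2) m4
    convert this using 1
    module
  repeat' (first | apply S.add_mem | apply S.smul_mem | assumption)

/-- `a * (a * x)` is in the span of `a`, `x`, `a * x`. -/
lemma mul_mul_mem {α β : F} (hαβ : α ≠ β) {a : A} (ha : IsPrimJAxis F A α β a)
    (S : Submodule F A) {x : A} (h_a : a ∈ S) (h_x : x ∈ S) (h_ax : a * x ∈ S) :
    a * (a * x) ∈ S := by
  have haa := ha.1.idem
  obtain ⟨p, u, v, hu, hv, rfl⟩ := prim_decomp ha x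
  obtain ⟨mu, mv⟩ := comps_mem hαβ haa S hu hv h_a h_x h_ax
  simp only [mul_add, mul_smul_comm, haa, hu, hv]
  repeat' (first | apply S.add_mem | apply S.smul_mem | assumption)

/-- The odd part of an element of an `ad_a`-invariant submodule stays inside. -/
lemma odd_mem {α β : F} (hαβ : α ≠ β) {a : A} (ha : IsPrimJAxis F A α β a)
    (S : Submodule F A) (h_a : a ∈ S) (hS : ∀ x ∈ S, a * x ∈ S) {e o : A}
    (he : e ∈ eigSp F A a 1 ⊔ eigSp F A a α) (ho : a * o = β • o) (h : e + o ∈ S) :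
    e ∈ S ∧ o ∈ S := by
  obtain ⟨k, hk⟩ := even_decomp ha he
  have h3 := hS _ h
  rw [mul_add, hk, ho] at h3
  have hd : α - β ≠ 0 := sub_ne_zero.2 hαβ
  have e1 : o ∈ S := by
    refine (S.smul_mem_iff hd).1 ?_
    have := S.sub_mem (S.add_mem (S.smul_mem α h) (S.smul_mem k h_a)) h3
    convert this using 1
    module
  exact ⟨(S.add_mem_iff_left e1).1 h, e1⟩

/-- The multiplier of an `ad_a`-invariant submodule is `ad_a`-invariant. -/
lemma multiplier_inv {α β : F} (hαβ : α ≠ β) {a : A} (ha : IsPrimJAxis F A α β a)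
    (S : Submodule F A) (h_a : a ∈ S) (hS : ∀ x ∈ S, a * x ∈ S) {m : A}
    (hm : ∀ y ∈ S, m * y ∈ S) : ∀ y ∈ S, (a * m) * y ∈ S := by
  have haa := ha.1.idem
  intro y hy
  obtain ⟨p, u, v, hu, hv, rfl⟩ := prim_decomp ha m
  obtain ⟨q, s, t, hs, ht, rfl⟩ := prim_decomp ha y
  have hay := hS _ hy
  obtain ⟨ms, mt⟩ := comps_mem hαβ haa S hs ht h_a hy hay
  have ha1 : a ∈ eigSp F A a 1 := by
    rw [ha.2]; exact Submodule.mem_span_singleton_self a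
  have ev : ∀ z, a * z = α • z → z ∈ eigSp F A a 1 ⊔ eigSp F A a α :=
    fun z hz => Submodule.mem_sup_right hz
  have hva : v * a = β • v := by rw [mul_comm, hv]
  have hua : u * a = α • u := by rw [mul_comm, hu]
  -- the product with `a`
  have r1 : v * a ∈ S := by
    have h := hm a h_a
    have : (p • a + α • u) + v * a ∈ S := by
      convert h using 1
      simp only [add_mul, smul_mul_assoc, haa, hua]
    refine (odd_mem hαβ ha S h_a hS ?_ ?_ this).2
    · exact Submodule.add_mem _ (Submodule.smul_mem _ _ (Submodule.mem_sup_left ha1))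
        (Submodule.smul_mem _ _ (ev u hu))
    · rw [hva, mul_smul_comm, hv]
  have r2 : v * s ∈ S := by
    have h := hm s ms
    have : (p • (α • s) + u * s) + v * s ∈ S := by
      convert h using 1
      simp only [add_mul, smul_mul_assoc, hs]
    refine (odd_mem hαβ ha S h_a hS ?_ ?_ this).2
    · exact Submodule.add_mem _ (Submodule.smul_mem _ _ (Submodule.smul_mem _ _ (ev s hs)))
        (ha.1.faa u hu s hs)
    · have h : a * (s * v) = β • (s * v) := ha.1.fab s hs v hv
      rwa [mul_comm s v] at h
  have r3 : v * t ∈ S := by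
    have h := hm t mt
    have : v * t + (p • (β • t) + u * t) ∈ S := by
      convert h using 1
      simp only [add_mul, smul_mul_assoc, ht]
      abel
    refine (odd_mem hαβ ha S h_a hS (ha.1.fbb v hv t ht) ?_ this).1
    have h : a * (u * t) = β • (u * t) := ha.1.fab u hu t ht
    rw [mul_add, h, mul_smul_comm, mul_smul_comm, ht]
    module
  have rv : v * (q • a + s + t) ∈ S := by
    rw [mul_add, mul_add, mul_smul_comm]
    exact S.add_mem (S.add_mem (S.smul_mem _ r1) r2) r3
  have h0 := hm _ hy
  have := S.add_mem (S.add_mem (S.smul_mem α h0) (S.smul_mem (p - α * p) hay))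
    (S.smul_mem (β - α) rv)
  convert this using 1
  have e : a * (p • a + u + v) = α • (p • a + u + v) + (p - α * p) • a + (β - α) • v := by
    simp only [mul_add, mul_smul_comm, haa, hu, hv]
    module
  rw [e, add_mul, add_mul, smul_mul_assoc, smul_mul_assoc, smul_mul_assoc]

lemma mul_span_le (S : Submodule F A) (G : Set A) (hG : S = Submodule.span F G) (a : A)
    (h : ∀ x ∈ G, a * x ∈ S) : ∀ x ∈ S, a * x ∈ S := by
  intro x hx
  rw [hG] at hx
  induction hx using Submodule.span_induction with
  | mem x hx => exact h x hx
  | zero => simp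
  | add x y _ _ hx hy => rw [mul_add]; exact S.add_mem hx hy
  | smul k x _ hx => rw [mul_smul_comm]; exact S.smul_mem k hx

end Helpers

theorem three_generated_span_eight (α β : F) (h2 : (2 : F) ≠ 0)
    (hα1 : α ≠ 1) (hβ1 : β ≠ 1) (hαβ : α ≠ β)
    (hA : IsJAxialAlg F A α β) (hstar : StarCond F A α β)
    (a b c : A) (ha : IsPrimJAxis F A α β a) (hb : IsPrimJAxis F A α β b)
    (hc : IsPrimJAxis F A α β c)
    (hgen : NonUnitalAlgebra.adjoin F {a, b, c} = ⊤)
    (hfus : ∀ x ∈ eigSp F A a α, ∀ y ∈ eigSp F A a α, x * y ∈ eigSp F A a 1) :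
    Submodule.span F
      {a, b, c, a * b, a * c, b * c, a * (b * c), b * (a * c)} = ⊤ ∧
    Module.finrank F A ≤ 8 := by
  have hspan : Submodule.span F
      {a, b, c, a * b, a * c, b * c, a * (b * c), b * (a * c)} = ⊤ := by
    set G : Set A := {a, b, c, a * b, a * c, b * c, a * (b * c), b * (a * c)} with hG
    set S := Submodule.span F G with hS
    have gm : ∀ x ∈ G, x ∈ S := fun x hx => Submodule.subset_span hx
    have ma : a ∈ S := gm _ (by simp [hG])
    have mb : b ∈ S := gm _ (by simp [hG])
    have mc : c ∈ S := gm _ (by simp [hG])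
    have mab : a * b ∈ S := gm _ (by simp [hG])
    have mac : a * c ∈ S := gm _ (by simp [hG])
    have mbc : b * c ∈ S := gm _ (by simp [hG])
    have mabc : a * (b * c) ∈ S := gm _ (by simp [hG])
    have mbac : b * (a * c) ∈ S := gm _ (by simp [hG])
    have mcab : a * b * c ∈ S :=
      third_mem hαβ ha hfus S ma mb mc mab mac mbc mabc mbac
    have mba : b * a ∈ S := by rwa [mul_comm]
    have mca : c * a ∈ S := by rwa [mul_comm]
    have mcb : c * b ∈ S := by rwa [mul_comm]
    obtain ⟨ka1, ka2⟩ := key_closure h2 hαβ ha S ma mb mc mab mac mbc mabc mcab mbac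
    obtain ⟨kb1, kb2⟩ := key_closure h2 hαβ hb S mb ma mc mba mbc mac mbac
      (by rwa [mul_comm b a]) mabc
    obtain ⟨kc1, kc2⟩ := key_closure h2 hαβ hc S mc ma mb mca mcb mab
      (by rwa [mul_comm c]) (by rwa [mul_comm (c * a), mul_comm c a]) (by rwa [mul_comm c b])
    have ia : ∀ x ∈ S, a * x ∈ S := by
      refine mul_span_le S G hS a ?_
      simp only [hG, Set.mem_insert_iff, Set.mem_singleton_iff, forall_eq_or_imp, forall_eq]
      refine ⟨by rwa [ha.1.idem], mab, mac, ?_, ?_, mabc, ?_, ka2⟩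
      · exact mul_mul_mem hαβ ha S ma mb mab
      · exact mul_mul_mem hαβ ha S ma mc mac
      · exact mul_mul_mem hαβ ha S ma mbc mabc
    have ib : ∀ x ∈ S, b * x ∈ S := by
      refine mul_span_le S G hS b ?_
      simp only [hG, Set.mem_insert_iff, Set.mem_singleton_iff, forall_eq_or_imp, forall_eq]
      refine ⟨mba, by rwa [hb.1.idem], mbc, ?_, mbac, ?_, kb2, ?_⟩
      · rw [mul_comm a b]; exact mul_mul_mem hαβ hb S mb ma mba
      · exact mul_mul_mem hαβ hb S mb mc mbc
      · exact mul_mul_mem hαβ hb S mb mac mbac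
    have ic : ∀ x ∈ S, c * x ∈ S := by
      refine mul_span_le S G hS c ?_
      simp only [hG, Set.mem_insert_iff, Set.mem_singleton_iff, forall_eq_or_imp, forall_eq]
      refine ⟨mca, mcb, by rwa [hc.1.idem], ?_, ?_, ?_, ?_, ?_⟩
      · rwa [mul_comm c]
      · rw [mul_comm a c]; exact mul_mul_mem hαβ hc S mc ma mca
      · rw [mul_comm b c]; exact mul_mul_mem hαβ hc S mc mb mcb
      · rwa [mul_comm b c]
      · rwa [mul_comm b, mul_comm a c]
    have ja := fun m => multiplier_inv hαβ ha S ma ia (m := m)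
    have jb := fun m => multiplier_inv hαβ hb S mb ib (m := m)
    have hmul : ∀ x ∈ S, ∀ y ∈ S, x * y ∈ S := by
      intro x hx y hy
      rw [mul_comm]
      refine mul_span_le S G hS y ?_ x hx
      intro z hz
      rw [mul_comm]
      revert y
      revert z
      simp only [hG, Set.mem_insert_iff, Set.mem_singleton_iff, forall_eq_or_imp, forall_eq]
      exact ⟨ia, ib, ic, ja _ ib, ja _ ic, jb _ ic, ja _ (jb _ ic), jb _ (ja _ ic)⟩
    rw [eq_top_iff]
    intro x _
    have hx : x ∈ NonUnitalAlgebra.adjoin F {a, b, c} := by rw [hgen]; trivial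
    induction hx using NonUnitalAlgebra.adjoin_induction with
    | mem x hx =>
      simp only [Set.mem_insert_iff, Set.mem_singleton_iff] at hx
      rcases hx with rfl | rfl | rfl <;> assumption
    | add x y _ _ hx hy => exact S.add_mem (hx trivial) (hy trivial)
    | zero => exact S.zero_mem
    | mul x y _ _ hx hy => exact hmul _ (hx trivial) _ (hy trivial)
    | smul k x _ hx => exact S.smul_mem k (hx trivial)
  refine ⟨hspan, ?_⟩
  classical
  rw [← finrank_top F A, ← hspan]
  let T : Finset A := {a, b, c, a * b, a * c, b * c, a * (b * c), b * (a * c)}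
  have h : Module.finrank F (Submodule.span F (T : Set A)) ≤ T.card :=
    finrank_span_finset_le_card T
  have hT : (T : Set A) = {a, b, c, a * b, a * c, b * c, a * (b * c), b * (a * c)} := by
    simp [T]
  rw [hT] at h
  refine h.trans ((Finset.card_insert_le _ _).trans (Nat.succ_le_succ ?_))
  exact (Finset.card_insert_le _ _).trans (Nat.succ_le_succ Finset.card_le_six)
end
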